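/- Let R be a GF-closed ring such that both l.Gwdim(R) and r.Gwdim(R) are finite. Then l.FFD(R) = l.Gwdim(R) = r.Gwdim(R) = r.FFD(R). -/

import Mathlib

/-!
Background definitions for D. Bennis, "Weak Gorenstein global dimensions".

Conventions.  All rings are associative with identity.  A *left* `R`-module is a type with
`[AddCommGroup M] [Module R M]`; a *right* `R`-module is a left module over the opposite ring,
i.e. `[Module Rᵐᵒᵖ M]`.  All "right-handed" notions below are obtained by applying the
corresponding "left-handed" notion to the opposite ring `Rᵐᵒᵖ`.
-/

open MulOpposite

universe u

section Tensor

variable (S : Type u) [Ring S]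

/-- The subgroup of relations defining the tensor product `A ⊗_S M` of a right `S`-module `A`
and a left `S`-module `M` over a (possibly noncommutative) ring `S`. -/
def tensorRels (A : Type u) [AddCommGroup A] [Module Sᵐᵒᵖ A]
    (M : Type u) [AddCommGroup M] [Module S M] :
    AddSubgroup (FreeAbelianGroup (A × M)) :=
  AddSubgroup.closure
    { x | (∃ a₁ a₂ m, x = FreeAbelianGroup.of (a₁ + a₂, m) - FreeAbelianGroup.of (a₁, m) -
            FreeAbelianGroup.of (a₂, m)) ∨
          (∃ a m₁ m₂, x = FreeAbelianGroup.of (a, m₁ + m₂) - FreeAbelianGroup.of (a, m₁) -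
            FreeAbelianGroup.of (a, m₂)) ∨
          (∃ (a : A) (r : S) (m : M), x = FreeAbelianGroup.of (op r • a, m) - FreeAbelianGroup.of (a, r • m)) }

/-- The tensor product `A ⊗_S M` (an abelian group) of a right `S`-module `A` and a left
`S`-module `M` over a (possibly noncommutative) ring `S`. -/
def NTensor (A : Type u) [AddCommGroup A] [Module Sᵐᵒᵖ A]
    (M : Type u) [AddCommGroup M] [Module S M] : Type u :=
  FreeAbelianGroup (A × M) ⧸ tensorRels S A M

instance (A : Type u) [AddCommGroup A] [Module Sᵐᵒᵖ A]
    (M : Type u) [AddCommGroup M] [Module S M] : AddCommGroup (NTensor S A M) :=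
  QuotientAddGroup.Quotient.addCommGroup _

namespace NTensor

variable {S}
variable {A A' : Type u} [AddCommGroup A] [Module Sᵐᵒᵖ A] [AddCommGroup A'] [Module Sᵐᵒᵖ A']
variable {M M' : Type u} [AddCommGroup M] [Module S M] [AddCommGroup M'] [Module S M']

/-- Functoriality of `A ⊗_S −` : the map `A ⊗_S M → A ⊗_S M'` induced by a linear map
`g : M → M'` of left `S`-modules. -/
def rmap (A : Type u) [AddCommGroup A] [Module Sᵐᵒᵖ A] (g : M →ₗ[S] M') :
    NTensor S A M →+ NTensor S A M' :=
  QuotientAddGroup.map (tensorRels S A M) (tensorRels S A M') (FreeAbelianGroup.map (Prod.map id g)) (by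
    simp only [tensorRels]
    refine (AddSubgroup.closure_le _).2 ?_
    rintro x (⟨a₁, a₂, m, rfl⟩ | ⟨a, m₁, m₂, rfl⟩ | ⟨a, r, m, rfl⟩) <;>
      refine SetLike.mem_coe.2 (AddSubgroup.mem_comap.2 (AddSubgroup.subset_closure ?_)) <;>
      simp only [map_sub, map_add, map_smul, FreeAbelianGroup.map_of_apply, Prod.map_apply,
        id_eq, Set.mem_setOf_eq]
    · exact Or.inl ⟨a₁, a₂, g m, rfl⟩
    · exact Or.inr (Or.inl ⟨a, g m₁, g m₂, rfl⟩)
    · exact Or.inr (Or.inr ⟨a, r, g m, rfl⟩))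

/-- Functoriality of `− ⊗_S M` : the map `A ⊗_S M → A' ⊗_S M` induced by a linear map
`f : A → A'` of right `S`-modules. -/
def lmap (M : Type u) [AddCommGroup M] [Module S M] (f : A →ₗ[Sᵐᵒᵖ] A') :
    NTensor S A M →+ NTensor S A' M :=
  QuotientAddGroup.map (tensorRels S A M) (tensorRels S A' M) (FreeAbelianGroup.map (Prod.map f id)) (by
    simp only [tensorRels]
    refine (AddSubgroup.closure_le _).2 ?_
    rintro x (⟨a₁, a₂, m, rfl⟩ | ⟨a, m₁, m₂, rfl⟩ | ⟨a, r, m, rfl⟩) <;>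
      refine SetLike.mem_coe.2 (AddSubgroup.mem_comap.2 (AddSubgroup.subset_closure ?_)) <;>
      simp only [map_sub, map_add, map_smul, FreeAbelianGroup.map_of_apply, Prod.map_apply,
        id_eq, Set.mem_setOf_eq]
    · exact Or.inl ⟨f a₁, f a₂, m, rfl⟩
    · exact Or.inr (Or.inl ⟨f a, m₁, m₂, rfl⟩)
    · exact Or.inr (Or.inr ⟨f a, r, m, rfl⟩))

end NTensor

end Tensor

section Dims

variable (S : Type u) [Ring S]

/-- A left `S`-module `M` is *flat* if tensoring with it preserves injectivity of maps of
right `S`-modules. -/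
def IsFlatMod (M : ModuleCat.{u} S) : Prop :=
  ∀ (A B : Type u) [AddCommGroup A] [Module Sᵐᵒᵖ A] [AddCommGroup B] [Module Sᵐᵒᵖ B]
    (f : A →ₗ[Sᵐᵒᵖ] B), Function.Injective f →
      Function.Injective (NTensor.lmap (↥M) f)

/-- A left `S`-module `M` is *Gorenstein flat* if there is an exact sequence
`⋯ → F (-1) → F 0 → F 1 → ⋯` of flat left `S`-modules with `M ≅ Im (F 0 → F 1)` which stays
exact after applying `I ⊗_S −` for every injective right `S`-module `I`
(a *complete flat resolution*). -/
def IsGorensteinFlat (M : ModuleCat.{u} S) : Prop :=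
  ∃ (F : ℤ → ModuleCat.{u} S) (d : ∀ n : ℤ, ↥(F n) →ₗ[S] ↥(F (n + 1))),
    (∀ n, IsFlatMod S (F n)) ∧
    (∀ n, Function.Exact (d n) (d (n + 1))) ∧
    Nonempty (↥M ≃ₗ[S] ↥(LinearMap.range (d 0))) ∧
    (∀ (I : Type u) [AddCommGroup I] [Module Sᵐᵒᵖ I], Module.Injective Sᵐᵒᵖ I →
      ∀ n, Function.Exact (NTensor.rmap I (d n)) (NTensor.rmap I (d (n + 1))))

/-- `gflatDimLE S n M` means `Gfd_S(M) ≤ n`: there is an exact sequence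
`0 → G_n → ⋯ → G_0 → M → 0` of left `S`-modules with all `G_i` Gorenstein flat. -/
def gflatDimLE : ℕ → ModuleCat.{u} S → Prop
  | 0, M => IsGorensteinFlat S M
  | n + 1, M => ∃ (K G : ModuleCat.{u} S) (ι : ↥K →ₗ[S] ↥G) (π : ↥G →ₗ[S] ↥M),
      Function.Injective ι ∧ Function.Surjective π ∧ Function.Exact ι π ∧
      IsGorensteinFlat S G ∧ gflatDimLE n K

/-- `flatDimLE S n M` means `fd_S(M) ≤ n`: there is an exact sequence
`0 → F_n → ⋯ → F_0 → M → 0` of left `S`-modules with all `F_i` flat. -/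
def flatDimLE : ℕ → ModuleCat.{u} S → Prop
  | 0, M => IsFlatMod S M
  | n + 1, M => ∃ (K F : ModuleCat.{u} S) (ι : ↥K →ₗ[S] ↥F) (π : ↥F →ₗ[S] ↥M),
      Function.Injective ι ∧ Function.Surjective π ∧ Function.Exact ι π ∧
      IsFlatMod S F ∧ flatDimLE n K

/-- `injDimLE S n M` means `id_S(M) ≤ n`: there is an exact sequence
`0 → M → I^0 → ⋯ → I^n → 0` of left `S`-modules with all `I^i` injective. -/
def injDimLE : ℕ → ModuleCat.{u} S → Prop
  | 0, M => Module.Injective S ↥M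
  | n + 1, M => ∃ (I C : ModuleCat.{u} S) (ι : ↥M →ₗ[S] ↥I) (π : ↥I →ₗ[S] ↥C),
      Function.Injective ι ∧ Function.Surjective π ∧ Function.Exact ι π ∧
      Module.Injective S ↥I ∧ injDimLE n C

/-- The Gorenstein flat dimension `Gfd_S(M) ∈ ℕ∞` of a left `S`-module `M`. -/
noncomputable def gflatDim (M : ModuleCat.{u} S) : ℕ∞ :=
  sInf {d : ℕ∞ | ∃ n : ℕ, d = n ∧ gflatDimLE S n M}

/-- The flat dimension `fd_S(M) ∈ ℕ∞` of a left `S`-module `M`. -/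
noncomputable def flatDim (M : ModuleCat.{u} S) : ℕ∞ :=
  sInf {d : ℕ∞ | ∃ n : ℕ, d = n ∧ flatDimLE S n M}

/-- The injective dimension `id_S(M) ∈ ℕ∞` of a left `S`-module `M`. -/
noncomputable def injDim (M : ModuleCat.{u} S) : ℕ∞ :=
  sInf {d : ℕ∞ | ∃ n : ℕ, d = n ∧ injDimLE S n M}

/-- The left weak Gorenstein global dimension
`l.Gwdim(S) = sup { Gfd_S(M) | M a left S-module }`.  The right weak Gorenstein global
dimension of `S` is `gorensteinWeakGlobalDim Sᵐᵒᵖ`. -/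
noncomputable def gorensteinWeakGlobalDim : ℕ∞ :=
  ⨆ M : ModuleCat.{u} S, gflatDim S M

/-- The left weak global dimension `sup { fd_S(M) | M a left S-module }`.  (By a classical
theorem it agrees with `weakGlobalDim Sᵐᵒᵖ`, and the common value is `wdim S`.) -/
noncomputable def weakGlobalDim : ℕ∞ :=
  ⨆ M : ModuleCat.{u} S, flatDim S M

/-- The left finitistic flat dimension
`l.FFD(S) = sup { fd_S(M) | M a left S-module with fd_S(M) < ∞ }`. -/
noncomputable def finitisticFlatDim : ℕ∞ :=
  sSup {d : ℕ∞ | d ≠ ⊤ ∧ ∃ M : ModuleCat.{u} S, flatDim S M = d}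

/-- The left finitistic Gorenstein flat dimension
`l.FGFD(S) = sup { Gfd_S(M) | M a left S-module with Gfd_S(M) < ∞ }`. -/
noncomputable def finitisticGFlatDim : ℕ∞ :=
  sSup {d : ℕ∞ | d ≠ ⊤ ∧ ∃ M : ModuleCat.{u} S, gflatDim S M = d}

/-- A ring `S` is *left GF-closed* if the class of Gorenstein flat left `S`-modules is closed
under extensions.  `S` is right GF-closed iff `Sᵐᵒᵖ` is left GF-closed, and GF-closed if both. -/
def IsGFClosed : Prop :=
  ∀ (A B C : ModuleCat.{u} S) (f : ↥A →ₗ[S] ↥B) (g : ↥B →ₗ[S] ↥C),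
    Function.Injective f → Function.Surjective g → Function.Exact f g →
      IsGorensteinFlat S A → IsGorensteinFlat S C → IsGorensteinFlat S B

/-- A ring `S` is *left coherent* if every finitely generated left ideal of `S` is finitely
presented (as a left `S`-module).  `S` is right coherent iff `Sᵐᵒᵖ` is left coherent. -/
def IsLeftCoherent : Prop :=
  ∀ I : Submodule S S, I.FG → Module.FinitePresentation S ↥I

/-- A ring `S` is *left IF* if every injective left `S`-module is flat.  `S` is right IF iff
`Sᵐᵒᵖ` is left IF, and IF if both. -/
def IsLeftIF : Prop :=
  ∀ E : ModuleCat.{u} S, Module.Injective S ↥E → IsFlatMod S E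

/-- A ring `S` is *left `n`-IF* if `fd_S(E) ≤ n` for every injective left `S`-module `E`.
`S` is right `n`-IF iff `Sᵐᵒᵖ` is left `n`-IF, and `n`-IF if both. -/
def IsLeftNIF (n : ℕ) : Prop :=
  ∀ E : ModuleCat.{u} S, Module.Injective S ↥E → flatDim S E ≤ (n : ℕ∞)

/-- `Ext¹_S(T, K) = 0`, expressed by its standard characterization: every extension of `T`
by `K` (i.e. every short exact sequence `0 → K → X → T → 0`) splits. -/
def Ext1Zero (T K : ModuleCat.{u} S) : Prop :=
  ∀ (X : ModuleCat.{u} S) (ι : ↥K →ₗ[S] ↥X) (π : ↥X →ₗ[S] ↥T),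
    Function.Injective ι → Function.Surjective π → Function.Exact ι π →
      ∃ ρ : ↥X →ₗ[S] ↥K, ρ.comp ι = LinearMap.id

/-- A left `S`-module `K` is *cotorsion* if `Ext¹_S(F, K) = 0` for every flat left
`S`-module `F`. -/
def IsCotorsion (K : ModuleCat.{u} S) : Prop :=
  ∀ F : ModuleCat.{u} S, IsFlatMod S F → Ext1Zero S F K

/-- `Tor₁^S(A, T) = 0` for a right `S`-module `A` and a left `S`-module `T`, expressed by its
standard characterization: for every short exact sequence `0 → K → F → T → 0` of left
`S`-modules with `F` flat, the induced map `A ⊗_S K → A ⊗_S F` is injective. -/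
def Tor1Zero (A : Type u) [AddCommGroup A] [Module Sᵐᵒᵖ A] (T : ModuleCat.{u} S) : Prop :=
  ∀ (K F : ModuleCat.{u} S) (ι : ↥K →ₗ[S] ↥F) (π : ↥F →ₗ[S] ↥T),
    IsFlatMod S F → Function.Injective ι → Function.Surjective π → Function.Exact ι π →
      Function.Injective (NTensor.rmap A ι)

/-- A left `S`-module is *finitely presented* if it admits a presentation with finitely many
generators and relations. -/
abbrev IsFinitelyPresented (M : ModuleCat.{u} S) : Prop :=
  Module.FinitePresentation S ↥M

end Dims

open CategoryTheory CategoryTheory.Abelian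

/-! ### Characters and the noncommutative tensor product -/

section Characters

variable {S : Type u} [Ring S]

/-- The character group of a right `S`-module is a left `S`-module. -/
instance CharacterModule.leftModule (A : Type u) [AddCommGroup A] [Module Sᵐᵒᵖ A] :
    Module S (CharacterModule A) where
  smul s c := (c : A →+ AddCircle (1 : ℚ)).comp (DistribSMul.toAddMonoidHom A (op s))
  one_smul c := by
    refine CharacterModule.ext _ fun a => ?_
    change c (op (1 : S) • a) = c a
    simp
  mul_smul r s c := by
    refine CharacterModule.ext _ fun a => ?_
    change c (op (r * s) • a) = c (op s • op r • a)
    rw [smul_smul, op_mul]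
  smul_zero _ := rfl
  smul_add _ _ _ := rfl
  add_smul r s c := by
    refine CharacterModule.ext _ fun a => ?_
    change c (op (r + s) • a) = c (op r • a) + c (op s • a)
    rw [MulOpposite.op_add, add_smul, map_add]
  zero_smul c := by
    refine CharacterModule.ext _ fun a => ?_
    change c (op (0 : S) • a) = 0
    simp

theorem CharacterModule.left_smul_apply {A : Type u} [AddCommGroup A] [Module Sᵐᵒᵖ A] (s : S)
    (c : CharacterModule A) (a : A) : (s • c) a = c (op s • a) := rfl

/-- The left `S`-module of characters of a right `S`-module. -/
abbrev charDual (S : Type u) [Ring S] (A : Type u) [AddCommGroup A] [Module Sᵐᵒᵖ A] :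
    ModuleCat.{u} S :=
  ModuleCat.of S (CharacterModule A)

/-- The map on characters induced by a linear map of right `S`-modules. -/
def charDualMap {A B : Type u} [AddCommGroup A] [Module Sᵐᵒᵖ A] [AddCommGroup B]
    [Module Sᵐᵒᵖ B] (f : A →ₗ[Sᵐᵒᵖ] B) : CharacterModule B →ₗ[S] CharacterModule A where
  toFun c := (c : B →+ AddCircle (1 : ℚ)).comp f.toAddMonoidHom
  map_add' _ _ := rfl
  map_smul' s c := by
    refine CharacterModule.ext _ fun a => ?_
    change c (op s • f a) = c (f (op s • a))
    rw [f.map_smul]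

theorem charDualMap_apply {A B : Type u} [AddCommGroup A] [Module Sᵐᵒᵖ A] [AddCommGroup B]
    [Module Sᵐᵒᵖ B] (f : A →ₗ[Sᵐᵒᵖ] B) (c : CharacterModule B) (a : A) :
    charDualMap f c a = c (f a) := rfl

theorem CharacterModule.exists_comp_eq {A B : Type u} [AddCommGroup A] [AddCommGroup B]
    (f : A →+ B) (hf : Function.Injective f) (c : CharacterModule A) :
    ∃ c' : CharacterModule B, ∀ a, c' (f a) = c a := by
  obtain ⟨c', h⟩ := CharacterModule.dual_surjective_of_injective f.toIntLinearMap hf c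
  exact ⟨c', fun a => congrArg (fun d : CharacterModule A => d a) h⟩

theorem CharacterModule.exists_apply_ne_zero_of_notMem {A : Type u} [AddCommGroup A]
    (H : AddSubgroup A) {a : A} (ha : a ∉ H) :
    ∃ c : CharacterModule A, (∀ b ∈ H, c b = 0) ∧ c a ≠ 0 := by
  have hne : (QuotientAddGroup.mk' H a) ≠ 0 := fun h => ha ((QuotientAddGroup.eq_zero_iff a).1 h)
  obtain ⟨c, hc⟩ := CharacterModule.exists_character_apply_ne_zero_of_ne_zero hne
  refine ⟨(c : _ →+ AddCircle (1 : ℚ)).comp (QuotientAddGroup.mk' H), fun b hb => ?_, hc⟩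
  change c (QuotientAddGroup.mk' H b) = 0
  rw [show QuotientAddGroup.mk' H b = 0 from (QuotientAddGroup.eq_zero_iff b).2 hb, map_zero]

theorem CharacterModule.exists_comp_eq_of_ker {A B : Type u} [AddCommGroup A] [AddCommGroup B]
    (f : A →+ B) (c : CharacterModule A) (hc : ∀ a, f a = 0 → c a = 0) :
    ∃ c' : CharacterModule B, ∀ a, c' (f a) = c a := by
  obtain ⟨c', h⟩ := CharacterModule.exists_comp_eq (QuotientAddGroup.kerLift f)
    (QuotientAddGroup.kerLift_injective f)
    (QuotientAddGroup.lift f.ker (c : A →+ AddCircle (1 : ℚ)) hc)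
  exact ⟨c', fun a => h (QuotientAddGroup.mk a)⟩

namespace NTensor

variable {A B : Type u} [AddCommGroup A] [Module Sᵐᵒᵖ A] [AddCommGroup B] [Module Sᵐᵒᵖ B]
variable {M N : Type u} [AddCommGroup M] [Module S M] [AddCommGroup N] [Module S N]

/-- The elementary tensor `a ⊗ m`. -/
def tmul (S : Type u) [Ring S] {A : Type u} [AddCommGroup A] [Module Sᵐᵒᵖ A]
    {M : Type u} [AddCommGroup M] [Module S M] (a : A) (m : M) : NTensor S A M :=
  QuotientAddGroup.mk' (tensorRels S A M) (FreeAbelianGroup.of (a, m))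

theorem tmul_add (a : A) (m n : M) : tmul S a (m + n) = tmul S a m + tmul S a n := by
  rw [← sub_eq_zero, ← sub_sub]
  exact (QuotientAddGroup.eq_zero_iff _).2
    (AddSubgroup.subset_closure (Or.inr (Or.inl ⟨a, m, n, rfl⟩)))

theorem add_tmul (a b : A) (m : M) : tmul S (a + b) m = tmul S a m + tmul S b m := by
  rw [← sub_eq_zero, ← sub_sub]
  exact (QuotientAddGroup.eq_zero_iff _).2
    (AddSubgroup.subset_closure (Or.inl ⟨a, b, m, rfl⟩))

theorem op_smul_tmul (s : S) (a : A) (m : M) : tmul S (op s • a) m = tmul S a (s • m) := by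
  rw [← sub_eq_zero]
  exact (QuotientAddGroup.eq_zero_iff _).2
    (AddSubgroup.subset_closure (Or.inr (Or.inr ⟨a, s, m, rfl⟩)))

theorem lmap_tmul (f : A →ₗ[Sᵐᵒᵖ] B) (a : A) (m : M) :
    lmap M f (tmul S a m) = tmul S (f a) m := rfl

theorem rmap_tmul (g : M →ₗ[S] N) (a : A) (m : M) :
    rmap A g (tmul S a m) = tmul S a (g m) := rfl

theorem character_ext {c c' : CharacterModule (NTensor S A M)}
    (h : ∀ a m, c (tmul S a m) = c' (tmul S a m)) : c = c' :=
  QuotientAddGroup.addMonoidHom_ext (M := AddCircle (1 : ℚ)) (tensorRels S A M)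
    (FreeAbelianGroup.lift_ext _ _ fun p => h p.1 p.2)

/-- The linear map into the character module attached to a character of the tensor product. -/
def curry (c : CharacterModule (NTensor S A M)) : M →ₗ[S] CharacterModule A where
  toFun m := AddMonoidHom.mk' (fun a => c (tmul S a m)) fun a b => by rw [add_tmul, map_add]
  map_add' m n := by
    refine CharacterModule.ext _ fun a => ?_
    change c (tmul S a (m + n)) = c (tmul S a m) + c (tmul S a n)
    rw [tmul_add, map_add]
  map_smul' s m := by
    refine CharacterModule.ext _ fun a => ?_
    change c (tmul S a (s • m)) = c (tmul S (op s • a) m)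
    rw [op_smul_tmul]

theorem curry_apply (c : CharacterModule (NTensor S A M)) (m : M) (a : A) :
    curry c m a = c (tmul S a m) := rfl

theorem exists_character (φ : M →ₗ[S] CharacterModule A) :
    ∃ c : CharacterModule (NTensor S A M), ∀ a m, c (tmul S a m) = φ m a := by
  refine ⟨QuotientAddGroup.lift (tensorRels S A M)
    (FreeAbelianGroup.lift fun p : A × M => φ p.2 p.1) ?_, fun a m => ?_⟩
  · refine (AddSubgroup.closure_le _).2 ?_
    rintro x (⟨a₁, a₂, m, rfl⟩ | ⟨a, m₁, m₂, rfl⟩ | ⟨a, r, m, rfl⟩)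
    · simp [AddMonoidHom.mem_ker]
    · have : (φ m₁ + φ m₂) a = φ m₁ a + φ m₂ a := rfl
      simp [AddMonoidHom.mem_ker, this]
    · simp [AddMonoidHom.mem_ker, CharacterModule.left_smul_apply]
  · exact FreeAbelianGroup.lift_apply_of _ _

theorem lmap_injective_iff (f : A →ₗ[Sᵐᵒᵖ] B) :
    Function.Injective (lmap M f) ↔
      ∀ φ : M →ₗ[S] CharacterModule A, ∃ ψ : M →ₗ[S] CharacterModule B,
        ∀ m a, ψ m (f a) = φ m a := by
  constructor
  · intro h φ
    obtain ⟨c, hc⟩ := exists_character φ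
    obtain ⟨c', hc'⟩ := CharacterModule.exists_comp_eq _ h c
    refine ⟨curry c', fun m a => ?_⟩
    rw [curry_apply, ← hc, ← hc', lmap_tmul]
  · intro h
    refine (injective_iff_map_eq_zero _).2 fun x hx =>
      CharacterModule.eq_zero_of_character_apply fun c => ?_
    obtain ⟨ψ, hψ⟩ := h (curry c)
    obtain ⟨c', hc'⟩ := exists_character ψ
    have : c = (c' : _ →+ AddCircle (1 : ℚ)).comp (lmap M f) := character_ext fun a m => by
      change _ = c' (tmul S (f a) m)
      rw [hc', hψ, curry_apply]
    rw [this]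
    change c' (lmap M f x) = 0
    rw [hx, map_zero]

theorem exact_rmap_iff {L : Type u} [AddCommGroup L] [Module S L] (f : L →ₗ[S] M)
    (g : M →ₗ[S] N) :
    Function.Exact (rmap A f) (rmap A g) ↔
      ∀ φ : M →ₗ[S] CharacterModule A, φ ∘ₗ f = 0 ↔
        ∃ ψ : N →ₗ[S] CharacterModule A, ψ ∘ₗ g = φ := by
  constructor
  · intro h φ
    obtain ⟨c, hc⟩ := exists_character φ
    constructor
    · intro hφ
      have hcf : (c : _ →+ AddCircle (1 : ℚ)).comp (rmap A f) = (0 : _ →+ _) :=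
        character_ext fun a m => by
          change c (tmul S a (f m)) = 0
          rw [hc, ← LinearMap.comp_apply, hφ]
          rfl
      obtain ⟨c', hc'⟩ := CharacterModule.exists_comp_eq_of_ker (rmap A g) c fun x hx => by
        obtain ⟨y, rfl⟩ := (h x).1 hx
        exact DFunLike.congr_fun hcf y
      refine ⟨curry c', LinearMap.ext fun m => CharacterModule.ext _ fun a => ?_⟩
      rw [LinearMap.comp_apply, curry_apply, ← rmap_tmul, hc', hc]
    · rintro ⟨ψ, rfl⟩
      refine LinearMap.ext fun l => CharacterModule.ext _ fun a => ?_
      obtain ⟨c', hc'⟩ := exists_character ψ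
      have h0 : rmap A g (rmap A f (tmul S a l)) = 0 := (h _).2 ⟨_, rfl⟩
      rw [rmap_tmul, rmap_tmul] at h0
      rw [LinearMap.comp_apply, LinearMap.comp_apply, ← hc', h0, map_zero]
      rfl
  · intro h x
    constructor
    · intro hx
      by_contra hn
      obtain ⟨c, hc, hcx⟩ := CharacterModule.exists_apply_ne_zero_of_notMem (rmap A f).range
        (a := x) hn
      obtain ⟨ψ, hψ⟩ := (h (curry c)).1 (LinearMap.ext fun l => CharacterModule.ext _ fun a =>
        hc _ ⟨tmul S a l, rfl⟩)
      obtain ⟨c', hc'⟩ := exists_character ψ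
      have : c = (c' : _ →+ AddCircle (1 : ℚ)).comp (rmap A g) := character_ext fun a m => by
        change _ = c' (tmul S a (g m))
        rw [hc', ← LinearMap.comp_apply, hψ, curry_apply]
      rw [this] at hcx
      refine hcx ?_
      change c' (rmap A g x) = 0
      rw [hx, map_zero]
    · rintro ⟨y, rfl⟩
      refine CharacterModule.eq_zero_of_character_apply fun c => ?_
      have h0 := (h (curry c ∘ₗ g)).2 ⟨_, rfl⟩
      have : (c : _ →+ AddCircle (1 : ℚ)).comp ((rmap A g).comp (rmap A f)) = (0 : _ →+ _) :=
        character_ext fun a l =>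
          congrArg (fun d : CharacterModule A => d a) (LinearMap.congr_fun h0 l)
      exact DFunLike.congr_fun this y

end NTensor

theorem isFlatMod_iff (M : ModuleCat.{u} S) :
    IsFlatMod S M ↔ ∀ (A B : Type u) [AddCommGroup A] [Module Sᵐᵒᵖ A] [AddCommGroup B]
      [Module Sᵐᵒᵖ B] (f : A →ₗ[Sᵐᵒᵖ] B), Function.Injective f →
        ∀ φ : M →ₗ[S] CharacterModule A, ∃ ψ : M →ₗ[S] CharacterModule B,
          ∀ m a, ψ m (f a) = φ m a := by
  unfold IsFlatMod
  simp only [NTensor.lmap_injective_iff]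

end Characters
/-! ### Short exact sequences and vanishing of `Ext` -/

section ExtVanishing

variable {S : Type u} [Ring S]

/-- The maps `f` and `g` form a short exact sequence `0 → K → G → M → 0`. -/
structure IsSES {K G M : Type u} [AddCommGroup K] [AddCommGroup G] [AddCommGroup M] [Module S K]
    [Module S G] [Module S M] (f : K →ₗ[S] G) (g : G →ₗ[S] M) : Prop where
  inj : Function.Injective f
  surj : Function.Surjective g
  exact : Function.Exact f g

namespace IsSES

section Maps

variable {K G M N : Type u} [AddCommGroup K] [AddCommGroup G] [AddCommGroup M] [AddCommGroup N]
  [Module S K] [Module S G] [Module S M] [Module S N] {f : K →ₗ[S] G} {g : G →ₗ[S] M}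

theorem comp_eq_zero (h : IsSES f g) : g ∘ₗ f = 0 :=
  LinearMap.ext h.exact.apply_apply_eq_zero

theorem exists_desc (h : IsSES f g) (φ : G →ₗ[S] N) (hφ : φ ∘ₗ f = 0) :
    ∃ χ : M →ₗ[S] N, χ ∘ₗ g = φ := by
  have hle : LinearMap.ker g ≤ LinearMap.ker φ := fun x hx => by
    obtain ⟨y, rfl⟩ := (h.exact x).1 hx
    exact LinearMap.congr_fun hφ y
  refine ⟨(LinearMap.ker g).liftQ φ hle ∘ₗ (g.quotKerEquivOfSurjective h.surj).symm.toLinearMap,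
    LinearMap.ext fun x => ?_⟩
  have : (g.quotKerEquivOfSurjective h.surj).symm (g x) = Submodule.Quotient.mk x :=
    (LinearEquiv.symm_apply_eq _).2 rfl
  simp [this]

end Maps

theorem of_ker {G M : Type u} [AddCommGroup G] [AddCommGroup M] [Module S G] [Module S M]
    {g : G →ₗ[S] M} (hg : Function.Surjective g) : IsSES (LinearMap.ker g).subtype g :=
  ⟨Subtype.val_injective, hg, fun x => by simp⟩

theorem of_range {K G : Type u} [AddCommGroup K] [AddCommGroup G] [Module S K] [Module S G]
    {f : K →ₗ[S] G} (hf : Function.Injective f) : IsSES f (LinearMap.range f).mkQ :=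
  ⟨hf, Submodule.mkQ_surjective _, fun x => by simp⟩

theorem charDualMap {A B C : Type u} [AddCommGroup A] [AddCommGroup B] [AddCommGroup C]
    [Module Sᵐᵒᵖ A] [Module Sᵐᵒᵖ B] [Module Sᵐᵒᵖ C] {f : A →ₗ[Sᵐᵒᵖ] B} {g : B →ₗ[Sᵐᵒᵖ] C}
    (h : IsSES f g) : IsSES (_root_.charDualMap g : _ →ₗ[S] _) (_root_.charDualMap f) where
  inj := (injective_iff_map_eq_zero _).2 fun c hc => CharacterModule.ext _ fun x => by
    obtain ⟨b, rfl⟩ := h.surj x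
    exact congrArg (fun d : CharacterModule B => d b) hc
  surj c := by
    obtain ⟨c', hc'⟩ := CharacterModule.exists_comp_eq f.toAddMonoidHom h.inj c
    exact ⟨c', CharacterModule.ext _ hc'⟩
  exact c := by
    constructor
    · intro hc
      obtain ⟨c', hc'⟩ := CharacterModule.exists_comp_eq_of_ker g.toAddMonoidHom c fun b hb => by
        obtain ⟨a, rfl⟩ := (h.exact b).1 hb
        exact congrArg (fun d : CharacterModule A => d a) hc
      exact ⟨c', CharacterModule.ext _ hc'⟩
    · rintro ⟨c, rfl⟩
      refine CharacterModule.ext _ fun a => ?_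
      rw [charDualMap_apply, charDualMap_apply, h.exact.apply_apply_eq_zero, map_zero]
      rfl

variable {K G M N : ModuleCat.{u} S} {f : K →ₗ[S] G} {g : G →ₗ[S] M}

/-- The short complex in `ModuleCat` attached to a short exact sequence. -/
abbrev shortComplex (h : IsSES f g) : ShortComplex (ModuleCat.{u} S) :=
  ModuleCat.shortComplexOfCompEqZero f g h.comp_eq_zero

theorem shortExact (h : IsSES f g) : h.shortComplex.ShortExact :=
  ModuleCat.shortComplex_shortExact _ h.exact h.inj h.surj

end IsSES

/-- Vanishing of `Ext^n(M, N)`. -/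
abbrev ExtZero (M N : ModuleCat.{u} S) (n : ℕ) : Prop := Subsingleton (Ext M N n)

theorem extZero_of_forall {M N : ModuleCat.{u} S} {n : ℕ} (h : ∀ x : Ext M N n, x = 0) :
    ExtZero M N n :=
  subsingleton_of_forall_eq 0 h

namespace IsSES

variable {K G M N : ModuleCat.{u} S} {f : K →ₗ[S] G} {g : G →ₗ[S] M}

theorem extZero_right (h : IsSES f g) {n : ℕ} (hK : ExtZero K N n) (hG : ExtZero G N (n + 1)) :
    ExtZero M N (n + 1) := extZero_of_forall fun x => by
  obtain ⟨y, rfl⟩ := Ext.contravariant_sequence_exact₃ h.shortExact N x (hG.elim _ _)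
    (add_comm 1 n)
  rw [hK.elim y 0, Ext.comp_zero]

theorem extZero_left (h : IsSES f g) {n : ℕ} (hG : ExtZero G N n) (hM : ExtZero M N (n + 1)) :
    ExtZero K N n := extZero_of_forall fun x => by
  obtain ⟨y, rfl⟩ := Ext.contravariant_sequence_exact₁ h.shortExact N x (add_comm 1 n)
    (hM.elim _ _)
  rw [hG.elim y 0, Ext.comp_zero]

theorem extZero_middle (h : IsSES f g) {n : ℕ} (hK : ExtZero K N n) (hM : ExtZero M N n) :
    ExtZero G N n := extZero_of_forall fun x => by
  obtain ⟨y, rfl⟩ := Ext.contravariant_sequence_exact₂ h.shortExact N x (hK.elim _ _)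
  rw [hM.elim y 0, Ext.comp_zero]

theorem extZero_coright (h : IsSES f g) {n : ℕ} (hG : ExtZero N G n)
    (hK : ExtZero N K (n + 1)) : ExtZero N M n := extZero_of_forall fun x => by
  obtain ⟨y, rfl⟩ := Ext.covariant_sequence_exact₃ N h.shortExact x rfl (hK.elim _ _)
  rw [hG.elim y 0, Ext.zero_comp]

theorem extZero_coleft (h : IsSES f g) {n : ℕ} (hM : ExtZero N M n)
    (hG : ExtZero N G (n + 1)) : ExtZero N K (n + 1) := extZero_of_forall fun x => by
  obtain ⟨y, rfl⟩ := Ext.covariant_sequence_exact₁ N h.shortExact x (hG.elim _ _) rfl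
  rw [hM.elim y 0, Ext.zero_comp]

theorem exists_extension (h : IsSES f g) (hM : ExtZero M N 1) (φ : K →ₗ[S] N) :
    ∃ ψ : G →ₗ[S] N, ψ ∘ₗ f = φ := by
  obtain ⟨y, hy⟩ := Ext.contravariant_sequence_exact₁ h.shortExact N
    (Ext.mk₀ (ModuleCat.ofHom φ)) (add_zero 1) (hM.elim _ _)
  obtain ⟨ψ, rfl⟩ := Ext.homEquiv₀.symm.surjective y
  have := Ext.mk₀_bijective _ _ |>.1 (by simpa using hy)
  exact ⟨ψ.hom, congrArg ModuleCat.Hom.hom this⟩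

theorem extZero_one_of_extension (h : IsSES f g) (hG : ExtZero G N 1)
    (hφ : ∀ φ : K →ₗ[S] N, ∃ ψ : G →ₗ[S] N, ψ ∘ₗ f = φ) : ExtZero M N 1 :=
  extZero_of_forall fun x => by
    obtain ⟨y, rfl⟩ := Ext.contravariant_sequence_exact₃ h.shortExact N x (hG.elim _ _)
      (add_zero 1)
    obtain ⟨φ, rfl⟩ := Ext.homEquiv₀.symm.surjective y
    obtain ⟨ψ, hψ⟩ := hφ φ.hom
    have : φ = h.shortComplex.f ≫ ModuleCat.ofHom ψ := by ext1; exact hψ.symm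
    subst this
    change h.shortExact.extClass.comp (Ext.mk₀ _) _ = 0
    rw [← Ext.mk₀_comp_mk₀, h.shortExact.extClass_comp_assoc]

theorem exists_lift (h : IsSES f g) (hK : ExtZero N K 1) (φ : N →ₗ[S] M) :
    ∃ ψ : N →ₗ[S] G, g ∘ₗ ψ = φ := by
  obtain ⟨y, hy⟩ := Ext.covariant_sequence_exact₃ N h.shortExact
    (Ext.mk₀ (ModuleCat.ofHom φ)) (zero_add 1) (hK.elim _ _)
  obtain ⟨ψ, rfl⟩ := Ext.homEquiv₀.symm.surjective y
  have := Ext.mk₀_bijective _ _ |>.1 (by simpa using hy)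
  exact ⟨ψ.hom, congrArg ModuleCat.Hom.hom this⟩

theorem extZero_one_of_lift (h : IsSES f g) (hG : ExtZero N G 1)
    (hφ : ∀ φ : N →ₗ[S] M, ∃ ψ : N →ₗ[S] G, g ∘ₗ ψ = φ) : ExtZero N K 1 :=
  extZero_of_forall fun x => by
    obtain ⟨y, rfl⟩ := Ext.covariant_sequence_exact₁ N h.shortExact x (hG.elim _ _)
      (zero_add 1)
    obtain ⟨φ, rfl⟩ := Ext.homEquiv₀.symm.surjective y
    obtain ⟨ψ, hψ⟩ := hφ φ.hom
    have : φ = ModuleCat.ofHom ψ ≫ h.shortComplex.g := by ext1; exact hψ.symm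
    subst this
    change (Ext.mk₀ _).comp h.shortExact.extClass _ = 0
    rw [← Ext.mk₀_comp_mk₀, Ext.comp_assoc (a₂₃ := 1) _ _ _ rfl rfl rfl,
      h.shortExact.comp_extClass, Ext.comp_zero]

end IsSES

theorem extZero_of_injective (M E : ModuleCat.{u} S) (hE : Module.Injective S E) (n : ℕ) :
    ExtZero M E (n + 1) :=
  have : Injective E := Module.injective_object_of_injective_module S E
  Ext.subsingleton_of_injective _ _ _

theorem injective_of_extZero (E : ModuleCat.{u} S) (h : ∀ M : ModuleCat.{u} S, ExtZero M E 1) :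
    Module.Injective S E where
  out X Y _ _ _ _ f hf φ := by
    obtain ⟨ψ, hψ⟩ := (IsSES.of_range hf).exists_extension (K := ModuleCat.of S X)
      (G := ModuleCat.of S Y) (M := ModuleCat.of S (Y ⧸ LinearMap.range f)) (N := E) (h _) φ
    exact ⟨ψ, fun x => LinearMap.congr_fun hψ x⟩

theorem exists_projective_cover (M : ModuleCat.{u} S) :
    ∃ (P K : ModuleCat.{u} S) (ι : K →ₗ[S] P) (π : P →ₗ[S] M), IsSES ι π ∧ Projective P := by
  refine ⟨Projective.over M, ModuleCat.of S (LinearMap.ker (Projective.π M).hom),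
    (LinearMap.ker (Projective.π M).hom).subtype, (Projective.π M).hom, IsSES.of_ker ?_, inferInstance⟩
  exact (ModuleCat.epi_iff_surjective _).1 inferInstance

theorem exists_injective_hull (M : ModuleCat.{u} S) :
    ∃ (E C : ModuleCat.{u} S) (ι : M →ₗ[S] E) (π : E →ₗ[S] C), IsSES ι π ∧
      Module.Injective S E := by
  obtain ⟨⟨E, hE, ι, hι⟩⟩ := EnoughInjectives.presentation M
  exact ⟨E, ModuleCat.of S (E ⧸ LinearMap.range ι.hom), ι.hom, (LinearMap.range ι.hom).mkQ,
    IsSES.of_range ((ModuleCat.mono_iff_injective _).1 hι),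
    Module.injective_module_of_injective_object S E⟩

end ExtVanishing

/-! ### Flat dimension in terms of `Ext` with values in character modules -/

section FlatDimension

variable {S : Type u} [Ring S]

theorem isFlatMod_of_extZero (M : ModuleCat.{u} S)
    (h : ∀ A : ModuleCat.{u} Sᵐᵒᵖ, ExtZero M (charDual S A) 1) : IsFlatMod S M := by
  refine (isFlatMod_iff M).2 fun A B _ _ _ _ f hf φ => ?_
  obtain ⟨ψ, hψ⟩ := ((IsSES.of_range hf).charDualMap (S := S)).exists_lift
    (K := charDual S (B ⧸ LinearMap.range f)) (G := charDual S B) (M := charDual S A) (N := M)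
    (h (ModuleCat.of _ _)) φ
  exact ⟨ψ, fun m a => congrArg (fun c : CharacterModule A => c a) (LinearMap.congr_fun hψ m)⟩

theorem isFlatMod_of_projective (P : ModuleCat.{u} S) [Projective P] : IsFlatMod S P :=
  isFlatMod_of_extZero P fun _ => Ext.subsingleton_of_projective _ _ _

theorem exists_flat_cover (M : ModuleCat.{u} S) :
    ∃ (P K : ModuleCat.{u} S) (ι : K →ₗ[S] P) (π : P →ₗ[S] M), IsSES ι π ∧ Projective P ∧
      IsFlatMod S P := by
  obtain ⟨P, K, ι, π, h, hP⟩ := exists_projective_cover M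
  exact ⟨P, K, ι, π, h, hP, isFlatMod_of_projective P⟩

/-- Exchange the arguments of a balanced pairing `X × A → ℚ/ℤ`, where the left `S`-module `X` is
also seen as a module over the double opposite ring. -/
theorem exists_flip {X A : Type u} [AddCommGroup X] [AddCommGroup A] [Module S X]
    [Module Sᵐᵒᵖᵐᵒᵖ X] [Module Sᵐᵒᵖ A] (hX : ∀ (s : S) (x : X), op (op s) • x = s • x)
    (g : X →ₗ[S] CharacterModule A) :
    ∃ φ : A →ₗ[Sᵐᵒᵖ] CharacterModule X, ∀ a x, φ a x = g x a := by
  refine ⟨⟨⟨fun a => AddMonoidHom.mk' (fun x => g x a) fun x y => ?_, fun a b => ?_⟩,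
    fun s a => ?_⟩, fun _ _ => rfl⟩
  · rw [map_add]
    rfl
  · refine CharacterModule.ext _ fun x => ?_
    exact map_add (g x) a b
  · refine CharacterModule.ext _ fun x => ?_
    change g x (s • a) = g (op s • x) a
    obtain ⟨s, rfl⟩ := op_surjective s
    rw [hX, g.map_smul]
    rfl

theorem exists_flip_symm {X A : Type u} [AddCommGroup X] [AddCommGroup A] [Module S X]
    [Module Sᵐᵒᵖᵐᵒᵖ X] [Module Sᵐᵒᵖ A] (hX : ∀ (s : S) (x : X), op (op s) • x = s • x)
    (φ : A →ₗ[Sᵐᵒᵖ] CharacterModule X) :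
    ∃ g : X →ₗ[S] CharacterModule A, ∀ x a, g x a = φ a x := by
  refine ⟨⟨⟨fun x => AddMonoidHom.mk' (fun a => φ a x) fun a b => ?_, fun x y => ?_⟩,
    fun s x => ?_⟩, fun _ _ => rfl⟩
  · rw [map_add]
    rfl
  · refine CharacterModule.ext _ fun a => ?_
    exact map_add (φ a) x y
  · refine CharacterModule.ext _ fun a => ?_
    change φ a (s • x) = φ (op s • a) x
    rw [← hX, φ.map_smul]
    rfl

/-- Lambek's criterion for right modules. -/
theorem isFlatMod_op_iff_injective (A : ModuleCat.{u} Sᵐᵒᵖ) :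
    IsFlatMod Sᵐᵒᵖ A ↔ Module.Injective S (charDual S A) := by
  rw [isFlatMod_iff]
  constructor
  · refine fun h => ⟨fun X Y _ _ _ _ f hf g => ?_⟩
    let _ : Module Sᵐᵒᵖᵐᵒᵖ X := Module.compHom X (RingEquiv.opOp S).symm.toRingHom
    let _ : Module Sᵐᵒᵖᵐᵒᵖ Y := Module.compHom Y (RingEquiv.opOp S).symm.toRingHom
    have hX : ∀ (s : S) (x : X), op (op s) • x = s • x := fun _ _ => rfl
    have hY : ∀ (s : S) (y : Y), op (op s) • y = s • y := fun _ _ => rfl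
    let f' : X →ₗ[Sᵐᵒᵖᵐᵒᵖ] Y := ⟨f.toAddHom, fun s x => f.map_smul s.unop.unop x⟩
    obtain ⟨φ, hφ⟩ := exists_flip hX g
    obtain ⟨ψ, hψ⟩ := h X Y f' hf φ
    obtain ⟨k, hk⟩ := exists_flip_symm hY ψ
    refine ⟨k, fun x => CharacterModule.ext _ fun a => ?_⟩
    exact (hk _ _).trans ((hψ a x).trans (hφ _ _))
  · intro h X Y _ _ _ _ f hf φ
    let _ : Module S X := Module.compHom X (RingEquiv.opOp S).toRingHom
    let _ : Module S Y := Module.compHom Y (RingEquiv.opOp S).toRingHom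
    have hX : ∀ (s : S) (x : X), op (op s) • x = s • x := fun _ _ => rfl
    have hY : ∀ (s : S) (y : Y), op (op s) • y = s • y := fun _ _ => rfl
    let f' : X →ₗ[S] Y := ⟨f.toAddHom, fun s x => f.map_smul (op (op s)) x⟩
    obtain ⟨g, hg⟩ := exists_flip_symm hX φ
    obtain ⟨k, hk⟩ := h.out f' hf g
    obtain ⟨ψ, hψ⟩ := exists_flip hY k
    refine ⟨ψ, fun a x => (hψ _ _).trans ?_⟩
    rw [← hg]
    exact congrArg (fun c : CharacterModule A => c a) (hk x)

theorem extZero_charDual_of_isFlatMod_op (M : ModuleCat.{u} S) {A : ModuleCat.{u} Sᵐᵒᵖ}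
    (hA : IsFlatMod Sᵐᵒᵖ A) (n : ℕ) : ExtZero M (charDual S A) (n + 1) :=
  extZero_of_injective _ _ ((isFlatMod_op_iff_injective A).1 hA) n

theorem extZero_charDual_of_isFlatMod {M : ModuleCat.{u} S} (hM : IsFlatMod S M) (n : ℕ)
    (A : ModuleCat.{u} Sᵐᵒᵖ) : ExtZero M (charDual S A) (n + 1) := by
  induction n generalizing A with
  | zero =>
    obtain ⟨P, B, ι, π, h, -, hP⟩ := exists_flat_cover A
    refine (h.charDualMap (S := S)).extZero_one_of_lift (K := charDual S A) (G := charDual S P)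
      (M := charDual S B) (N := M) (extZero_charDual_of_isFlatMod_op M hP 0) fun φ => ?_
    obtain ⟨ψ, hψ⟩ := (isFlatMod_iff M).1 hM _ _ ι h.inj φ
    exact ⟨ψ, LinearMap.ext fun m => CharacterModule.ext _ (hψ m)⟩
  | succ n ih =>
    obtain ⟨P, B, ι, π, h, -, hP⟩ := exists_flat_cover A
    exact (h.charDualMap (S := S)).extZero_coleft (K := charDual S A) (G := charDual S P)
      (M := charDual S B) (N := M) (ih B) (extZero_charDual_of_isFlatMod_op M hP _)

theorem extZero_of_flatDimLE {n : ℕ} {M : ModuleCat.{u} S} (hM : flatDimLE S n M) (k : ℕ)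
    (A : ModuleCat.{u} Sᵐᵒᵖ) : ExtZero M (charDual S A) (n + k + 1) := by
  induction n generalizing M with
  | zero => exact extZero_charDual_of_isFlatMod hM _ A
  | succ n ih =>
    obtain ⟨K, F, ι, π, h₁, h₂, h₃, hF, hK⟩ := hM
    rw [Nat.add_right_comm n 1 k]
    exact IsSES.extZero_right ⟨h₁, h₂, h₃⟩ (ih hK) (extZero_charDual_of_isFlatMod hF _ A)

theorem flatDimLE_of_extZero {n : ℕ} {M : ModuleCat.{u} S}
    (h : ∀ A : ModuleCat.{u} Sᵐᵒᵖ, ExtZero M (charDual S A) (n + 1)) : flatDimLE S n M := by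
  induction n generalizing M with
  | zero => exact isFlatMod_of_extZero M h
  | succ n ih =>
    obtain ⟨P, K, ι, π, hs, -, hP⟩ := exists_flat_cover M
    exact ⟨K, P, ι, π, hs.inj, hs.surj, hs.exact, hP, ih fun A =>
      hs.extZero_left (extZero_charDual_of_isFlatMod hP _ A) (h A)⟩

theorem flatDimLE_mono {n m : ℕ} (hnm : n ≤ m) {M : ModuleCat.{u} S} (hM : flatDimLE S n M) :
    flatDimLE S m M := by
  obtain ⟨k, rfl⟩ := Nat.exists_eq_add_of_le hnm
  exact flatDimLE_of_extZero (extZero_of_flatDimLE hM k)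

theorem extZero_of_flatDimLE_op {n : ℕ} {A : ModuleCat.{u} Sᵐᵒᵖ} (hA : flatDimLE Sᵐᵒᵖ n A)
    (k : ℕ) (M : ModuleCat.{u} S) : ExtZero M (charDual S A) (n + k + 1) := by
  induction n generalizing A with
  | zero => exact extZero_charDual_of_isFlatMod_op M hA _
  | succ n ih =>
    obtain ⟨B, F, ι, π, h₁, h₂, h₃, hF, hB⟩ := hA
    rw [Nat.add_right_comm n 1 k]
    exact (IsSES.charDualMap (S := S) ⟨h₁, h₂, h₃⟩).extZero_coleft (K := charDual S A)
      (G := charDual S F) (M := charDual S B) (N := M) (ih hB)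
      (extZero_charDual_of_isFlatMod_op M hF _)

theorem flatDimLE_op_of_extZero {n : ℕ} {A : ModuleCat.{u} Sᵐᵒᵖ}
    (h : ∀ M : ModuleCat.{u} S, ExtZero M (charDual S A) (n + 1)) : flatDimLE Sᵐᵒᵖ n A := by
  induction n generalizing A with
  | zero => exact (isFlatMod_op_iff_injective A).2 (injective_of_extZero _ h)
  | succ n ih =>
    obtain ⟨P, B, ι, π, hs, -, hP⟩ := exists_flat_cover A
    exact ⟨B, P, ι, π, hs.inj, hs.surj, hs.exact, hP, ih fun M =>
      (hs.charDualMap (S := S)).extZero_coright (K := charDual S A) (G := charDual S P)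
        (M := charDual S B) (N := M) (extZero_charDual_of_isFlatMod_op M hP _) (h M)⟩

end FlatDimension

/-! ### Gorenstein flat modules -/

section GorensteinFlat

variable {S : Type u} [Ring S]

theorem extZero_of_linearEquiv {M M' N : ModuleCat.{u} S} (e : M ≃ₗ[S] M') {n : ℕ}
    (h : ExtZero M' N n) : ExtZero M N n := extZero_of_forall fun x => by
  have hx : (Ext.mk₀ e.toModuleIso.hom).comp
      ((Ext.mk₀ e.toModuleIso.inv).comp x (zero_add n)) (zero_add n) = x := by
    rw [Ext.mk₀_comp_mk₀_assoc, Iso.hom_inv_id, Ext.mk₀_id_comp]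
  rw [← hx, h.elim ((Ext.mk₀ e.toModuleIso.inv).comp x (zero_add n)) 0, Ext.comp_zero]

theorem extZero_of_isGorensteinFlat {G : ModuleCat.{u} S} (hG : IsGorensteinFlat S G)
    (I : ModuleCat.{u} Sᵐᵒᵖ) (hI : Module.Injective Sᵐᵒᵖ I) (k : ℕ) :
    ExtZero G (charDual S I) (k + 1) := by
  obtain ⟨F, d, hF, hd, ⟨e⟩, hT⟩ := hG
  have hses : ∀ n, IsSES (LinearMap.range (d n)).subtype (d (n + 1)).rangeRestrict := fun n =>
    ⟨Subtype.val_injective, LinearMap.surjective_rangeRestrict _, fun x => by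
      rw [← LinearMap.mem_ker, LinearMap.ker_rangeRestrict, LinearMap.mem_ker, hd n x]
      simp⟩
  suffices h : ∀ n : ℤ, ExtZero (ModuleCat.of S (LinearMap.range (d n))) (charDual S I) (k + 1)
    from extZero_of_linearEquiv (M' := ModuleCat.of S (LinearMap.range (d 0))) e (h 0)
  induction k with
  | zero =>
    intro n
    obtain ⟨n, rfl⟩ : ∃ m, n = m + 1 + 1 := ⟨n - 2, by ring⟩
    refine (hses (n + 1)).extZero_one_of_extension
      (K := ModuleCat.of S (LinearMap.range (d (n + 1)))) (G := F (n + 1 + 1))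
      (M := ModuleCat.of S (LinearMap.range (d (n + 1 + 1)))) (N := charDual S I)
      (extZero_charDual_of_isFlatMod (hF _) 0 I) fun φ => ?_
    obtain ⟨ψ, hψ⟩ := ((NTensor.exact_rmap_iff _ _).1 (hT I hI n)
      (φ ∘ₗ (d (n + 1)).rangeRestrict)).1 (LinearMap.ext fun x => by
        have : (d (n + 1)).rangeRestrict (d n x) = 0 :=
          Subtype.ext ((hd n).apply_apply_eq_zero x)
        rw [LinearMap.comp_apply, LinearMap.comp_apply, this, map_zero]
        rfl)
    refine ⟨ψ, LinearMap.ext ?_⟩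
    rintro ⟨_, x, rfl⟩
    exact LinearMap.congr_fun hψ x
  | succ k ih =>
    intro n
    obtain ⟨n, rfl⟩ : ∃ m, n = m + 1 := ⟨n - 1, by ring⟩
    exact (hses n).extZero_right (K := ModuleCat.of S (LinearMap.range (d n))) (G := F (n + 1))
      (M := ModuleCat.of S (LinearMap.range (d (n + 1)))) (N := charDual S I) (ih n)
      (extZero_charDual_of_isFlatMod (hF _) _ I)

theorem extZero_of_gflatDimLE {n : ℕ} {M : ModuleCat.{u} S} (hM : gflatDimLE S n M)
    (I : ModuleCat.{u} Sᵐᵒᵖ) (hI : Module.Injective Sᵐᵒᵖ I) (k : ℕ) :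
    ExtZero M (charDual S I) (n + k + 1) := by
  induction n generalizing M with
  | zero => exact extZero_of_isGorensteinFlat hM I hI _
  | succ n ih =>
    obtain ⟨K, G, ι, π, h₁, h₂, h₃, hG, hK⟩ := hM
    rw [Nat.add_right_comm n 1 k]
    exact IsSES.extZero_right ⟨h₁, h₂, h₃⟩ (ih hK) (extZero_of_isGorensteinFlat hG I hI _)

/-- A relation that can be continued in both directions admits a bi-infinite chain through every
element. -/
theorem exists_int_chain {α : Type*} {r : α → α → Prop} (hr : ∀ x, ∃ y, r x y)
    (hl : ∀ x, ∃ y, r y x) (x : α) (k : ℤ) :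
    ∃ Z : ℤ → α, Z k = x ∧ ∀ n, r (Z n) (Z (n + 1)) := by
  choose R hR using hr
  choose L hL using hl
  let W : ℤ → α := fun n => Int.rec (fun m => R^[m] x) (fun m => L^[m + 1] x) n
  have hW : ∀ n, r (W n) (W (n + 1)) := by
    rintro (m | _ | m)
    · change r (R^[m] x) (R^[m + 1] x)
      rw [Function.iterate_succ_apply']
      exact hR _
    · exact hL x
    · change r (L^[m + 1 + 1] x) (L^[m + 1] x)
      rw [Function.iterate_succ_apply' L (m + 1)]
      exact hL _
  refine ⟨fun n => W (n - k), ?_, fun n => ?_⟩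
  · simp only [sub_self]
    rfl
  · have := hW (n - k)
    rwa [show n - k + 1 = n + 1 - k by ring] at this

/-- Modules `X` and `Y` related by a short exact sequence `0 → X → F → Y → 0` with `F` flat. -/
def FlatLinked (X Y : ModuleCat.{u} S) : Prop :=
  ∃ (F : ModuleCat.{u} S) (ι : X →ₗ[S] F) (π : F →ₗ[S] Y), IsFlatMod S F ∧ IsSES ι π

/-- A class of modules which is `Ext`-orthogonal to the characters of injective modules and in
which every module is linked through flat modules to members of the class on both sides consists
of Gorenstein flat modules. -/
theorem isGorensteinFlat_of_class (P : ModuleCat.{u} S → Prop)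
    (hext : ∀ X, P X → ∀ I : ModuleCat.{u} Sᵐᵒᵖ, Module.Injective Sᵐᵒᵖ I →
      ExtZero X (charDual S I) 1)
    (hl : ∀ X, P X → ∃ Y, P Y ∧ FlatLinked Y X) (hr : ∀ X, P X → ∃ Y, P Y ∧ FlatLinked X Y)
    {X : ModuleCat.{u} S} (hX : P X) : IsGorensteinFlat S X := by
  obtain ⟨Z, hZ, hlink⟩ := exists_int_chain (α := {X // P X})
    (r := fun X Y => FlatLinked X.1 Y.1)
    (fun X => (hr X.1 X.2).elim fun Y h => ⟨⟨Y, h.1⟩, h.2⟩)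
    (fun X => (hl X.1 X.2).elim fun Y h => ⟨⟨Y, h.1⟩, h.2⟩) ⟨X, hX⟩ (0 + 1)
  choose F ι π hF hs using hlink
  have hker : ∀ n, LinearMap.ker (ι (n + 1) ∘ₗ π n) = LinearMap.ker (π n) := fun n =>
    LinearMap.ker_comp_of_ker_eq_bot _ (LinearMap.ker_eq_bot.2 (hs (n + 1)).inj)
  have hrange : ∀ n, LinearMap.range (ι (n + 1) ∘ₗ π n) = LinearMap.range (ι (n + 1)) := fun n =>
    LinearMap.range_comp_of_range_eq_top _ (LinearMap.range_eq_top.2 (hs n).surj)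
  refine ⟨F, fun n => ι (n + 1) ∘ₗ π n, hF, fun n => ?_, ?_, fun I _ _ hI n => ?_⟩
  · rw [LinearMap.exact_iff, hker, hrange]
    exact (hs (n + 1)).exact.linearMap_ker_eq
  · have hXZ : X = (Z (0 + 1)).1 := by rw [hZ]
    subst hXZ
    exact ⟨(LinearEquiv.ofInjective _ (hs (0 + 1)).inj).trans
      (LinearEquiv.ofEq _ _ (hrange 0).symm)⟩
  · refine (NTensor.exact_rmap_iff _ _).2 fun φ => ⟨fun hφ => ?_, ?_⟩
    · obtain ⟨χ, hχ⟩ := (hs (n + 1)).exists_desc φ (LinearMap.ext fun x => by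
        obtain ⟨y, rfl⟩ := (hs n).surj x
        exact LinearMap.congr_fun hφ y)
      obtain ⟨ψ, hψ⟩ := (hs (n + 1 + 1)).exists_extension (N := charDual S I)
        (hext _ (Z _).2 (ModuleCat.of _ I) hI) χ
      exact ⟨ψ, by rw [← hχ, ← hψ, LinearMap.comp_assoc]⟩
    · rintro ⟨ψ, rfl⟩
      refine LinearMap.ext fun x => ?_
      simp only [LinearMap.comp_apply, (hs (n + 1)).exact.apply_apply_eq_zero, map_zero,
        LinearMap.zero_apply]

theorem isGorensteinFlat_of_isFlatMod {F : ModuleCat.{u} S} (hF : IsFlatMod S F) :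
    IsGorensteinFlat S F := by
  have hzero : IsFlatMod S (ModuleCat.of S PUnit.{u + 1}) :=
    (isFlatMod_iff _).2 fun A B _ _ _ _ f _ φ => ⟨0, fun m a => by
      rw [Subsingleton.elim m 0, map_zero, map_zero]
      rfl⟩
  refine isGorensteinFlat_of_class (IsFlatMod S)
    (fun X hX I _ => extZero_charDual_of_isFlatMod hX 0 I) (fun X hX => ?_) (fun X hX => ?_) hF
  · exact ⟨_, hzero, X, 0, LinearMap.id, hX, Function.injective_of_subsingleton _,
      Function.surjective_id, fun x => by simp [eq_comm]⟩
  · exact ⟨_, hzero, X, LinearMap.id, 0, hX, Function.injective_id,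
      Function.surjective_to_subsingleton _, fun x => by simp⟩

end GorensteinFlat

/-! ### Syzygies -/

section Syzygies

variable {S : Type u} [Ring S]

/-- `X` is an `n`-th flat syzygy of `M`. -/
def IsSyzygy : ℕ → ModuleCat.{u} S → ModuleCat.{u} S → Prop
  | 0, M, X => X = M
  | n + 1, M, X => ∃ K, FlatLinked K M ∧ IsSyzygy n K X

theorem exists_flatLinked (M : ModuleCat.{u} S) : ∃ K, FlatLinked K M := by
  obtain ⟨P, K, ι, π, h, -, hP⟩ := exists_flat_cover M
  exact ⟨K, P, ι, π, hP, h⟩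

theorem exists_isSyzygy (n : ℕ) (M : ModuleCat.{u} S) : ∃ X, IsSyzygy n M X := by
  induction n generalizing M with
  | zero => exact ⟨M, rfl⟩
  | succ n ih =>
    obtain ⟨K, hK⟩ := exists_flatLinked M
    obtain ⟨X, hX⟩ := ih K
    exact ⟨X, K, hK, hX⟩

theorem IsSyzygy.extZero {n : ℕ} {M X : ModuleCat.{u} S} (h : IsSyzygy n M X) {k : ℕ}
    {A : ModuleCat.{u} Sᵐᵒᵖ} (hM : ExtZero M (charDual S A) (n + k + 1)) :
    ExtZero X (charDual S A) (k + 1) := by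
  induction n generalizing M with
  | zero =>
    rw [Nat.zero_add] at hM
    exact h ▸ hM
  | succ n ih =>
    obtain ⟨K, ⟨F, ι, π, hF, hs⟩, hK⟩ := h
    rw [Nat.add_right_comm n 1 k] at hM
    exact ih hK (hs.extZero_left (extZero_charDual_of_isFlatMod hF _ A) hM)

theorem IsSyzygy.exists_shift {n : ℕ} {M X Y : ModuleCat.{u} S} (h : IsSyzygy n M X)
    (hY : FlatLinked Y X) : ∃ K, FlatLinked K M ∧ IsSyzygy n K Y := by
  induction n generalizing M with
  | zero =>
    subst h
    exact ⟨Y, hY, rfl⟩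
  | succ n ih =>
    obtain ⟨K, hK, hX⟩ := h
    exact ⟨K, hK, ih hX⟩

theorem IsSyzygy.gflatDimLE {n : ℕ} {M X : ModuleCat.{u} S} (h : IsSyzygy n M X)
    (hX : IsGorensteinFlat S X) : gflatDimLE S n M := by
  induction n generalizing M with
  | zero => exact h ▸ hX
  | succ n ih =>
    obtain ⟨K, ⟨F, ι, π, hF, hs⟩, hK⟩ := h
    exact ⟨K, F, ι, π, hs.inj, hs.surj, hs.exact, isGorensteinFlat_of_isFlatMod hF, ih hK⟩

theorem IsFlatMod.prod {F P : ModuleCat.{u} S} (hF : IsFlatMod S F) (hP : IsFlatMod S P) :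
    IsFlatMod S (ModuleCat.of S (F × P)) :=
  isFlatMod_of_extZero _ fun A => IsSES.extZero_middle (K := F) (M := P)
    (f := LinearMap.inl S F P) (g := LinearMap.snd S F P)
    ⟨LinearMap.inl_injective, LinearMap.snd_surjective, Function.Exact.inl_snd⟩
    (extZero_charDual_of_isFlatMod hF 0 A) (extZero_charDual_of_isFlatMod hP 0 A)

/-- One step of the horseshoe lemma. -/
theorem FlatLinked.horseshoe {K M E C : ModuleCat.{u} S} (hK : FlatLinked K M) {i : M →ₗ[S] E}
    {p : E →ₗ[S] C} (h : IsSES i p) :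
    ∃ (K' K'' : ModuleCat.{u} S) (f : K →ₗ[S] K') (g : K' →ₗ[S] K''),
      FlatLinked K' E ∧ FlatLinked K'' C ∧ IsSES f g := by
  obtain ⟨F, ι, π, hF, hs⟩ := hK
  obtain ⟨P, K'', ι', π', hs', _, hP⟩ := exists_flat_cover C
  obtain ⟨q, hq⟩ := h.exists_lift (N := P) (Ext.subsingleton_of_projective _ _ _) π'
  have hq : ∀ x, p (q x) = π' x := LinearMap.congr_fun hq
  let σ : (F × P) →ₗ[S] E := (i ∘ₗ π).coprod q
  have hσ : Function.Surjective σ := fun e => by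
    obtain ⟨x, hx⟩ := hs'.surj (p e)
    obtain ⟨m, hm⟩ := (h.exact (e - q x)).1 (by rw [map_sub, hq, hx, sub_self])
    obtain ⟨y, rfl⟩ := hs.surj m
    exact ⟨(y, x), by simp [σ, hm]⟩
  have hker : ∀ z : LinearMap.ker σ, ∃ k, ι' k = z.1.2 := fun z => (hs'.exact _).1 (by
    have hz : i (π z.1.1) + q z.1.2 = 0 := LinearMap.mem_ker.1 z.2
    have hpz := congrArg p hz
    rwa [map_add, h.exact.apply_apply_eq_zero, zero_add, hq, map_zero] at hpz)
  let eι := LinearEquiv.ofInjective ι' hs'.inj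
  let g : LinearMap.ker σ →ₗ[S] K'' := eι.symm.toLinearMap ∘ₗ
    ((LinearMap.snd S F P ∘ₗ (LinearMap.ker σ).subtype).codRestrict (LinearMap.range ι') hker)
  have hg : ∀ z, ι' (g z) = z.1.2 := fun z =>
    congrArg Subtype.val (eι.apply_symm_apply ⟨z.1.2, hker z⟩)
  let f : K →ₗ[S] LinearMap.ker σ := (LinearMap.inl S F P ∘ₗ ι).codRestrict (LinearMap.ker σ)
    fun k => by simp [σ, hs.exact.apply_apply_eq_zero]
  have hf : ∀ k, (f k).1 = (ι k, 0) := fun _ => rfl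
  refine ⟨ModuleCat.of S (LinearMap.ker σ), K'', f, g,
    ⟨_, _, σ, hF.prod hP, IsSES.of_ker hσ⟩, ⟨P, ι', π', hP, hs'⟩, ?_, ?_, ?_⟩
  · intro a b hab
    have : (f a).1 = (f b).1 := congrArg Subtype.val hab
    rw [hf, hf] at this
    exact hs.inj (Prod.ext_iff.1 this).1
  · intro k
    obtain ⟨m, hm⟩ := (h.exact (q (ι' k))).1 (by rw [hq, hs'.exact.apply_apply_eq_zero])
    obtain ⟨y, rfl⟩ := hs.surj m
    refine ⟨⟨(-y, ι' k), by simp [σ, hm]⟩, hs'.inj ?_⟩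
    rw [hg]
  · intro z
    constructor
    · intro hz
      have hz2 : z.1.2 = 0 := by rw [← hg, hz, map_zero]
      have hz1 : i (π z.1.1) = 0 := by
        have : i (π z.1.1) + q z.1.2 = 0 := LinearMap.mem_ker.1 z.2
        rwa [hz2, map_zero, add_zero] at this
      obtain ⟨k, hk⟩ := (hs.exact z.1.1).1 (h.inj (by rw [hz1, map_zero]))
      exact ⟨k, Subtype.ext (Prod.ext hk hz2.symm)⟩
    · rintro ⟨k, rfl⟩
      exact hs'.inj (by rw [hg, hf, map_zero])

theorem IsSyzygy.horseshoe {n : ℕ} {M E C X : ModuleCat.{u} S} (hX : IsSyzygy n M X)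
    {i : M →ₗ[S] E} {p : E →ₗ[S] C} (h : IsSES i p) :
    ∃ (Y Z : ModuleCat.{u} S) (f : X →ₗ[S] Y) (g : Y →ₗ[S] Z),
      IsSyzygy n E Y ∧ IsSyzygy n C Z ∧ IsSES f g := by
  induction n generalizing M E C with
  | zero =>
    subst hX
    exact ⟨E, C, i, p, rfl, rfl, h⟩
  | succ n ih =>
    obtain ⟨K, hK, hX⟩ := hX
    obtain ⟨K', K'', f, g, hK', hK'', hs⟩ := hK.horseshoe h
    obtain ⟨Y, Z, a, b, hY, hZ, hs⟩ := ih hX hs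
    exact ⟨Y, Z, a, b, ⟨K', hK', hY⟩, ⟨K'', hK'', hZ⟩, hs⟩

end Syzygies

/-! ### Rings whose injective modules have bounded flat dimension -/

section InjectiveFlatDimension

variable {S : Type u} [Ring S]

/-- Every injective left `S`-module has flat dimension at most `n`. -/
def InjFlatDimLE (S : Type u) [Ring S] (n : ℕ) : Prop :=
  ∀ E : ModuleCat.{u} S, Module.Injective S E → flatDimLE S n E

theorem gflatDimLE_of_injFlatDimLE {n : ℕ} (hl : InjFlatDimLE S n) (hr : InjFlatDimLE Sᵐᵒᵖ n)
    (M : ModuleCat.{u} S) : gflatDimLE S n M := by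
  obtain ⟨X, hX⟩ := exists_isSyzygy n M
  refine hX.gflatDimLE (isGorensteinFlat_of_class (fun X => ∃ M, IsSyzygy n M X) ?_ ?_ ?_ ⟨M, hX⟩)
  · rintro X ⟨M, hX⟩ I hI
    exact hX.extZero (extZero_of_flatDimLE_op (hr I hI) 0 M)
  · rintro X ⟨M, hX⟩
    obtain ⟨Y, hY⟩ := exists_flatLinked X
    obtain ⟨K, -, hK⟩ := hX.exists_shift hY
    exact ⟨Y, ⟨K, hK⟩, hY⟩
  · rintro X ⟨M, hX⟩
    obtain ⟨E, C, i, p, hs, hE⟩ := exists_injective_hull M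
    obtain ⟨Y, Z, f, g, hY, hZ, hs⟩ := hX.horseshoe hs
    exact ⟨Z, ⟨C, hZ⟩, Y, f, g, isFlatMod_of_extZero Y fun A =>
      hY.extZero (extZero_of_flatDimLE (hl E hE) 0 A), hs⟩

theorem flatDimLE_of_injFlatDimLE_op {n d : ℕ} (h : InjFlatDimLE Sᵐᵒᵖ n) {M : ModuleCat.{u} S}
    (hM : flatDimLE S d M) : flatDimLE S n M := by
  have key : ∀ d, (∀ A : ModuleCat.{u} Sᵐᵒᵖ, ExtZero M (charDual S A) (n + d + 1)) →
      flatDimLE S n M := by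
    intro d
    induction d with
    | zero => exact flatDimLE_of_extZero
    | succ d ih =>
      refine fun hd => ih fun A => ?_
      obtain ⟨I, C, i, p, hs, hI⟩ := exists_injective_hull A
      exact (hs.charDualMap (S := S)).extZero_coright (K := charDual S C) (G := charDual S I)
        (M := charDual S A) (N := M) (extZero_of_flatDimLE_op (h I hI) d M) (hd C)
  exact key d fun A => by
    rw [add_comm n d]
    exact extZero_of_flatDimLE hM n A

theorem isFlatMod_of_ringEquiv {T : Type u} [Ring T] (e : S ≃+* T) {M : ModuleCat.{u} S}
    {N : ModuleCat.{u} T} (i : M ≃+ N) (hi : ∀ s m, i (s • m) = e s • i m)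
    (hN : IsFlatMod T N) : IsFlatMod S M := by
  refine (isFlatMod_iff M).2 fun A B _ _ _ _ f hf φ => ?_
  let _ : Module Tᵐᵒᵖ A := Module.compHom A (RingEquiv.op e.symm).toRingHom
  let _ : Module Tᵐᵒᵖ B := Module.compHom B (RingEquiv.op e.symm).toRingHom
  have hi' : ∀ t x, i.symm (t • x) = e.symm t • i.symm x := fun t x =>
    i.injective (by rw [hi]; simp)
  let f' : A →ₗ[Tᵐᵒᵖ] B := ⟨f.toAddHom, fun t a => f.map_smul (op (e.symm t.unop)) a⟩
  let φ' : N →ₗ[T] CharacterModule A :=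
    ⟨⟨fun x => φ (i.symm x), fun x y => by rw [map_add, map_add]⟩, fun t x => by
      change φ (i.symm (t • x)) = _
      rw [hi', φ.map_smul]
      rfl⟩
  obtain ⟨ψ, hψ⟩ := (isFlatMod_iff N).1 hN A B f' hf φ'
  refine ⟨⟨⟨fun m => ψ (i m), fun x y => by rw [map_add, map_add]⟩, fun s m => ?_⟩, fun m a => ?_⟩
  · change ψ (i (s • m)) = _
    rw [hi, ψ.map_smul]
    refine CharacterModule.ext _ fun b => ?_
    change ψ (i m) (op (e.symm (e s)) • b) = ψ (i m) (op s • b)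
    rw [e.symm_apply_apply]
  · refine (hψ (i m) a).trans ?_
    change φ (i.symm (i m)) a = φ m a
    rw [i.symm_apply_apply]

theorem flatDimLE_of_ringEquiv {T : Type u} [Ring T] (e : S ≃+* T) {n : ℕ} {M : ModuleCat.{u} S}
    {N : ModuleCat.{u} T} (i : M ≃+ N) (hi : ∀ s m, i (s • m) = e s • i m)
    (hN : flatDimLE T n N) : flatDimLE S n M := by
  induction n generalizing M N with
  | zero => exact isFlatMod_of_ringEquiv e i hi hN
  | succ n ih =>
    obtain ⟨K, F, ι, π, h₁, h₂, h₃, hF, hK⟩ := hN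
    let _ : Module S K := Module.compHom K e.toRingHom
    let _ : Module S F := Module.compHom F e.toRingHom
    have hi' : ∀ s x, i.symm (e s • x) = s • i.symm x := fun s x =>
      i.injective (by rw [hi]; simp)
    refine ⟨ModuleCat.of S K, ModuleCat.of S F, ⟨ι.toAddHom, fun s x => ι.map_smul (e s) x⟩,
      ⟨⟨fun x => i.symm (π x), fun x y => by rw [map_add, map_add]⟩, fun s x => ?_⟩, h₁,
      i.symm.surjective.comp h₂, fun x => ?_,
      isFlatMod_of_ringEquiv e (AddEquiv.refl _) (fun _ _ => rfl) hF,
      ih (AddEquiv.refl _) (fun _ _ => rfl) hK⟩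
    · change i.symm (π (e s • x)) = s • i.symm (π x)
      rw [π.map_smul, hi']
    · exact (map_eq_zero_iff i.symm i.symm.injective).trans (h₃ x)

theorem InjFlatDimLE.of_ringEquiv {T : Type u} [Ring T] (e : S ≃+* T) {n : ℕ}
    (h : InjFlatDimLE T n) : InjFlatDimLE S n := fun E hE => by
  let _ : Module T E := Module.compHom E e.symm.toRingHom
  refine flatDimLE_of_ringEquiv e (N := ModuleCat.of T E) (AddEquiv.refl _)
    (fun s m => ?_) (h _ ⟨fun X Y _ _ _ _ f hf g => ?_⟩)
  · change s • m = e.symm (e s) • m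
    rw [e.symm_apply_apply]
  · let _ : Module S X := Module.compHom X e.toRingHom
    let _ : Module S Y := Module.compHom Y e.toRingHom
    obtain ⟨k, hk⟩ := hE.out (⟨f.toAddHom, fun s x => f.map_smul (e s) x⟩ : X →ₗ[S] Y) hf
      ⟨g.toAddHom, fun s x => (g.map_smul (e s) x).trans (by
        change e.symm (e s) • g x = s • g x
        rw [e.symm_apply_apply])⟩
    refine ⟨⟨k.toAddHom, fun t y => ?_⟩, hk⟩
    have := k.map_smul (e.symm t) y
    change k (e (e.symm t) • y) = e.symm t • k y at this
    rw [e.apply_symm_apply] at this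
    exact this

end InjectiveFlatDimension

/-! ### Comparison of the dimensions -/

section Comparison

variable {S : Type u} [Ring S]

theorem flatDim_le_of_flatDimLE {n : ℕ} {M : ModuleCat.{u} S} (h : flatDimLE S n M) :
    flatDim S M ≤ n :=
  sInf_le ⟨n, rfl, h⟩

theorem exists_flatDim_eq {M : ModuleCat.{u} S} (h : flatDim S M ≠ ⊤) :
    ∃ n : ℕ, flatDim S M = n ∧ flatDimLE S n M := by
  have hne : {d : ℕ∞ | ∃ n : ℕ, d = n ∧ flatDimLE S n M}.Nonempty := by
    by_contra hn
    refine h ?_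
    rw [flatDim, Set.not_nonempty_iff_eq_empty.1 hn, sInf_empty]
  exact csInf_mem hne

theorem exists_gflatDim_eq {M : ModuleCat.{u} S} (h : gflatDim S M ≠ ⊤) :
    ∃ n : ℕ, gflatDim S M = n ∧ gflatDimLE S n M := by
  have hne : {d : ℕ∞ | ∃ n : ℕ, d = n ∧ gflatDimLE S n M}.Nonempty := by
    by_contra hn
    refine h ?_
    rw [gflatDim, Set.not_nonempty_iff_eq_empty.1 hn, sInf_empty]
  exact csInf_mem hne

theorem injFlatDimLE_op_of_gorensteinWeakGlobalDim_le {n : ℕ}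
    (h : gorensteinWeakGlobalDim S ≤ n) : InjFlatDimLE Sᵐᵒᵖ n := fun I hI =>
  flatDimLE_op_of_extZero fun M => by
    have hM : gflatDim S M ≤ n := (le_iSup (gflatDim S) M).trans h
    obtain ⟨k, hk, hle⟩ := exists_gflatDim_eq (ne_top_of_le_ne_top (ENat.natCast_ne_top n) hM)
    rw [hk, Nat.cast_le] at hM
    obtain ⟨j, rfl⟩ := Nat.exists_eq_add_of_le hM
    exact extZero_of_gflatDimLE hle I hI j

theorem finitisticFlatDim_le_of_injFlatDimLE_op {n : ℕ} (h : InjFlatDimLE Sᵐᵒᵖ n) :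
    finitisticFlatDim S ≤ n := by
  refine sSup_le ?_
  rintro _ ⟨hd, M, rfl⟩
  obtain ⟨k, -, hk⟩ := exists_flatDim_eq hd
  exact flatDim_le_of_flatDimLE (flatDimLE_of_injFlatDimLE_op h hk)

theorem injFlatDimLE_of_finitisticFlatDim_le {n k : ℕ} (h : finitisticFlatDim S ≤ n)
    (hk : InjFlatDimLE S k) : InjFlatDimLE S n := fun E hE => by
  have hne : flatDim S E ≠ ⊤ :=
    ne_top_of_le_ne_top (ENat.natCast_ne_top k) (flatDim_le_of_flatDimLE (hk E hE))
  obtain ⟨m, hm, hle⟩ := exists_flatDim_eq hne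
  have hmn : flatDim S E ≤ n := le_trans (b := finitisticFlatDim S) (le_sSup ⟨hne, E, rfl⟩) h
  rw [hm, Nat.cast_le] at hmn
  exact flatDimLE_mono hmn hle

theorem gorensteinWeakGlobalDim_le_of_injFlatDimLE {n : ℕ} (hl : InjFlatDimLE S n)
    (hr : InjFlatDimLE Sᵐᵒᵖ n) : gorensteinWeakGlobalDim S ≤ n :=
  iSup_le fun M => sInf_le ⟨n, rfl, gflatDimLE_of_injFlatDimLE hl hr M⟩

end Comparison

/-- **Proposition 2.6.**  If `R` is a GF-closed ring with finite left and right weak Gorenstein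
global dimensions, then `l.FFD(R) = l.Gwdim(R) = r.Gwdim(R) = r.FFD(R)`. -/
theorem finitisticFlatDim_eq_gorensteinWeakGlobalDim (R : Type u) [Ring R]
    (hl : IsGFClosed R) (hr : IsGFClosed Rᵐᵒᵖ)
    (hfl : gorensteinWeakGlobalDim R ≠ ⊤) (hfr : gorensteinWeakGlobalDim Rᵐᵒᵖ ≠ ⊤) :
    finitisticFlatDim R = gorensteinWeakGlobalDim R ∧
    gorensteinWeakGlobalDim R = gorensteinWeakGlobalDim Rᵐᵒᵖ ∧
    gorensteinWeakGlobalDim Rᵐᵒᵖ = finitisticFlatDim Rᵐᵒᵖ := by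
  obtain ⟨a, ha⟩ := ENat.ne_top_iff_exists.1 hfl
  obtain ⟨b, hb⟩ := ENat.ne_top_iff_exists.1 hfr
  have hop : ∀ {n}, InjFlatDimLE R n → InjFlatDimLE Rᵐᵒᵖᵐᵒᵖ n :=
    InjFlatDimLE.of_ringEquiv (RingEquiv.opOp R).symm
  have hunop : ∀ {n}, InjFlatDimLE Rᵐᵒᵖᵐᵒᵖ n → InjFlatDimLE R n :=
    InjFlatDimLE.of_ringEquiv (RingEquiv.opOp R)
  have hra : InjFlatDimLE Rᵐᵒᵖ a := injFlatDimLE_op_of_gorensteinWeakGlobalDim_le ha.ge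
  have hlb : InjFlatDimLE R b := hunop (injFlatDimLE_op_of_gorensteinWeakGlobalDim_le hb.ge)
  have hlr : ∀ n : ℕ, InjFlatDimLE R n ↔ InjFlatDimLE Rᵐᵒᵖ n := fun n =>
    ⟨fun h => injFlatDimLE_of_finitisticFlatDim_le
      (finitisticFlatDim_le_of_injFlatDimLE_op (hop h)) hra,
    fun h => injFlatDimLE_of_finitisticFlatDim_le
      (finitisticFlatDim_le_of_injFlatDimLE_op h) hlb⟩
  have hFl : ∀ n : ℕ, finitisticFlatDim R ≤ n ↔ InjFlatDimLE R n := fun n =>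
    ⟨fun h => injFlatDimLE_of_finitisticFlatDim_le h hlb,
    fun h => finitisticFlatDim_le_of_injFlatDimLE_op ((hlr n).1 h)⟩
  have hFr : ∀ n : ℕ, finitisticFlatDim Rᵐᵒᵖ ≤ n ↔ InjFlatDimLE R n := fun n =>
    ⟨fun h => (hlr n).2 (injFlatDimLE_of_finitisticFlatDim_le h hra),
    fun h => finitisticFlatDim_le_of_injFlatDimLE_op (hop h)⟩
  have hGl : ∀ n : ℕ, gorensteinWeakGlobalDim R ≤ n ↔ InjFlatDimLE R n := fun n =>
    ⟨fun h => (hlr n).2 (injFlatDimLE_op_of_gorensteinWeakGlobalDim_le h),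
    fun h => gorensteinWeakGlobalDim_le_of_injFlatDimLE h ((hlr n).1 h)⟩
  have hGr : ∀ n : ℕ, gorensteinWeakGlobalDim Rᵐᵒᵖ ≤ n ↔ InjFlatDimLE R n := fun n =>
    ⟨fun h => hunop (injFlatDimLE_op_of_gorensteinWeakGlobalDim_le h),
    fun h => gorensteinWeakGlobalDim_le_of_injFlatDimLE ((hlr n).1 h) (hop h)⟩
  have heq : ∀ {x y : ℕ∞}, (∀ n : ℕ, x ≤ n ↔ InjFlatDimLE R n) →
      (∀ n : ℕ, y ≤ n ↔ InjFlatDimLE R n) → x = y := fun hx hy =>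
    eq_of_forall_ge_iff fun c => by
      induction c using ENat.recTopCoe with
      | top => simp
      | coe n => exact (hx n).trans (hy n).symm
  exact ⟨heq hFl hGl, heq hGl hGr, heq hGr hFr⟩
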